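/- arXiv:1411.1486 — 2 statements merged into one kernel-verified Lean document; each statement's English description precedes it below -/
import Mathlib

section
/- Let P_i be symmetric positive definite and H_{i,1} ∈ ℝ^{m×n}. Suppose [E_{i,H_{i,1}}(x,S)]ᵀ P_i [E_{i,H_{i,1}}(x,S)] − xᵀ P_i x < 0 for all x ≠ 0 and all S ⊆ {1,…,m}. Then for every x ≠ 0 with ‖H_{i,1} x‖_∞ ≤ 1, one has (F_i(x))ᵀ P_i F_i(x) < xᵀ P_i x. -/
open Matrix

/-- Componentwise saturation: `sat(u)_j = sign(u_j) * min 1 |u_j|`. -/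
noncomputable def satur {m : ℕ} (u : Fin m → ℝ) : Fin m → ℝ :=
  fun j => Real.sign (u j) * min 1 |u j|

/-- `E_{i,H}(x,S) = (A + ∑_{j∈Sᶜ} B^{•j} K^{j•}) x + (∑_{j∈S} B^{•j} H^{j•}) x`. -/
noncomputable def Emap {n m : ℕ} (A : Matrix (Fin n) (Fin n) ℝ)
    (B : Matrix (Fin n) (Fin m) ℝ) (K H : Matrix (Fin m) (Fin n) ℝ)
    (x : Fin n → ℝ) (S : Finset (Fin m)) : Fin n → ℝ :=
  (A + ∑ j ∈ Sᶜ, vecMulVec (fun r => B r j) (K j)).mulVec x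
    + (∑ j ∈ S, vecMulVec (fun r => B r j) (H j)).mulVec x

theorem satur_aux (k h : ℝ) (hh : |h| ≤ 1) :
    Real.sign k * min 1 |k| ∈ segment ℝ k h := by
  rw [segment_eq_uIcc, Set.mem_uIcc]
  obtain ⟨h1, h2⟩ := abs_le.mp hh
  rcases lt_trichotomy k 0 with hk | hk | hk
  · rw [Real.sign_of_neg hk, abs_of_neg hk]
    rcases min_cases 1 (-k) with ⟨e, _⟩ | ⟨e, _⟩ <;> rw [e]
    · left; constructor <;> linarith
    · rcases le_total k h with g | g
      · left; constructor <;> linarith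
      · right; constructor <;> linarith
  · subst hk
    rcases le_total 0 h with g | g
    · left; simp [g]
    · right; simp [g]
  · rw [Real.sign_of_pos hk, abs_of_pos hk]
    rcases min_cases 1 k with ⟨e, _⟩ | ⟨e, _⟩ <;> rw [e]
    · right; constructor <;> linarith
    · rcases le_total k h with g | g
      · left; constructor <;> linarith
      · right; constructor <;> linarith

theorem convex_aux {n m : ℕ} (B : Matrix (Fin n) (Fin m) ℝ) (P : Matrix (Fin n) (Fin n) ℝ)
    (hP : P.PosDef) (a : Fin n → ℝ) (c : ℝ) :
    Convex ℝ {w : Fin m → ℝ | (a + B.mulVec w) ⬝ᵥ P.mulVec (a + B.mulVec w) < c} := by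
  intro w hw v hv s t hs ht hst
  simp only [Set.mem_ofPred_eq] at hw hv ⊢
  have e : a + B.mulVec (s • w + t • v) = s • (a + B.mulVec w) + t • (a + B.mulVec v) := by
    rw [mulVec_add, mulVec_smul, mulVec_smul, smul_add, smul_add]
    nth_rewrite 1 [← one_smul ℝ a]
    rw [← hst, add_smul]
    abel
  rw [e]
  generalize a + B.mulVec w = p at *
  generalize a + B.mulVec v = q at *
  have hn : 0 ≤ (p - q) ⬝ᵥ P.mulVec (p - q) := by
    simpa using hP.posSemidef.dotProduct_mulVec_nonneg (p - q)
  simp only [mulVec_add, mulVec_sub, mulVec_smul, dotProduct_add, add_dotProduct, sub_dotProduct,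
    dotProduct_sub, smul_dotProduct, dotProduct_smul, smul_eq_mul] at hn ⊢
  obtain rfl : t = 1 - s := by linarith
  have h3 := mul_nonneg (mul_nonneg hs ht) hn
  rcases hs.eq_or_lt with rfl | hs'
  · nlinarith
  · nlinarith [mul_lt_mul_of_pos_left hw hs', mul_le_mul_of_nonneg_left hv.le ht]

theorem Emap_aux {n m : ℕ} (A : Matrix (Fin n) (Fin n) ℝ)
    (B : Matrix (Fin n) (Fin m) ℝ) (K H : Matrix (Fin m) (Fin n) ℝ)
    (x : Fin n → ℝ) (S : Finset (Fin m)) (w : Fin m → ℝ)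
    (h1 : ∀ j ∈ S, w j = H.mulVec x j) (h2 : ∀ j ∈ Sᶜ, w j = K.mulVec x j) :
    Emap A B K H x S = A.mulVec x + B.mulVec w := by
  have e : B.mulVec w = (∑ j ∈ Sᶜ, w j • (fun r => B r j)) + ∑ j ∈ S, w j • (fun r => B r j) := by
    rw [Finset.sum_compl_add_sum]
    ext i
    simp [mulVec, dotProduct, mul_comm]
  have f : ∀ (M : Matrix (Fin m) (Fin n) ℝ) (j : Fin m),
      (vecMulVec (fun r => B r j) (M j)).mulVec x = M.mulVec x j • (fun r => B r j) := by
    intro M j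
    ext i
    simp only [mulVec, dotProduct, vecMulVec_apply, Pi.smul_apply, smul_eq_mul, Finset.sum_mul]
    exact Finset.sum_congr rfl fun _ _ => by ring
  rw [e, Emap, add_mulVec, sum_mulVec, sum_mulVec, add_assoc]
  congr 2
  · exact Finset.sum_congr rfl fun j hj => by rw [f, h2 j hj]
  · exact Finset.sum_congr rfl fun j hj => by rw [f, h1 j hj]

/-- If the Lyapunov decrease holds at every LDI vertex `E_{i,H}(x,S)`, then it holds
for the saturated map `F_i(x) = A x + B sat(K x)` on the region `‖H x‖_∞ ≤ 1`. -/
theorem stmt7 {n m : ℕ} (A : Matrix (Fin n) (Fin n) ℝ) (B : Matrix (Fin n) (Fin m) ℝ)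
    (K H : Matrix (Fin m) (Fin n) ℝ) (P : Matrix (Fin n) (Fin n) ℝ) (hP : P.PosDef)
    (h : ∀ x : Fin n → ℝ, x ≠ 0 → ∀ S : Finset (Fin m),
      Emap A B K H x S ⬝ᵥ P.mulVec (Emap A B K H x S) - x ⬝ᵥ P.mulVec x < 0) :
    ∀ x : Fin n → ℝ, x ≠ 0 → ‖H.mulVec x‖ ≤ 1 →
      (A.mulVec x + B.mulVec (satur (K.mulVec x))) ⬝ᵥ
          P.mulVec (A.mulVec x + B.mulVec (satur (K.mulVec x)))
        < x ⬝ᵥ P.mulVec x := by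
  intro x hx hH
  have hbox : satur (K.mulVec x) ∈
      convexHull ℝ (Set.univ.pi fun j => ({K.mulVec x j, H.mulVec x j} : Set ℝ)) := by
    rw [convexHull_pi]
    intro j _
    beta_reduce
    rw [convexHull_pair]
    exact satur_aux _ _ ((norm_le_pi_norm (H.mulVec x) j).trans hH)
  refine convexHull_min ?_ (convex_aux B P hP (A.mulVec x) (x ⬝ᵥ P.mulVec x)) hbox
  intro w hw
  classical
  have := h x hx (Finset.univ.filter fun j => w j = H.mulVec x j)
  rw [Emap_aux A B K H x _ w (fun j hj => by simpa using hj) (fun j hj => by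
    have h1 := hw j (Set.mem_univ j)
    simp only [Set.mem_insert_iff, Set.mem_singleton_iff] at h1
    exact h1.resolve_right (by simpa using hj))] at this
  exact sub_neg.mp this
end

section
/- Let P_i, P_j be symmetric positive definite, let τ ≥ 1, and let H_{i,1},…,H_{i,τ} ∈ ℝ^{m×n}. Suppose [E_i^τ(x,S_1,…,S_τ)]ᵀ P_j [E_i^τ(x,S_1,…,S_τ)] − xᵀ P_i x < 0 for all x ≠ 0 and all S_1,…,S_τ ⊆ {1,…,m}. Then for every x ≠ 0 with ‖H_{i,k} x‖_∞ ≤ 1 for all k = 1,…,τ, one has (F_i^τ(x))ᵀ P_j F_i^τ(x) < xᵀ P_i x. -/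
open Matrix

/-- The closed-loop saturated map `F(x) = A x + B sat(K x)`. -/
noncomputable def Fmap {n m : ℕ} (A : Matrix (Fin n) (Fin n) ℝ)
    (B : Matrix (Fin n) (Fin m) ℝ) (K : Matrix (Fin m) (Fin n) ℝ)
    (x : Fin n → ℝ) : Fin n → ℝ :=
  A.mulVec x + B.mulVec (satur (K.mulVec x))

/-- Iterated vertex maps: `Eiter A B K H S x t` is `E_i^t(x, S_1, …, S_t)` where the
auxiliary matrix of the `k`-th nesting level is `H (k-1)` and `S_k = S (k-1)`. -/
noncomputable def Eiter {n m : ℕ} (A : Matrix (Fin n) (Fin n) ℝ)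
    (B : Matrix (Fin n) (Fin m) ℝ) (K : Matrix (Fin m) (Fin n) ℝ)
    (H : ℕ → Matrix (Fin m) (Fin n) ℝ) (S : ℕ → Finset (Fin m))
    (x : Fin n → ℝ) : ℕ → Fin n → ℝ
  | 0 => x
  | (k + 1) =>
      (A + ∑ j ∈ (S k)ᶜ, vecMulVec (fun r => B r j) (K j)).mulVec (Eiter A B K H S x k)
        + (∑ j ∈ S k, vecMulVec (fun r => B r j) (H k j)).mulVec x

theorem sat_mem_seg (u v : ℝ) (hv : |v| ≤ 1) :
    Real.sign u * min 1 |u| ∈ convexHull ℝ ({u, v} : Set ℝ) := by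
  rw [convexHull_pair, segment_eq_uIcc, Set.mem_uIcc]
  obtain ⟨h1, h2⟩ := abs_le.mp hv
  rcases lt_trichotomy u 0 with hu | hu | hu
  · rw [Real.sign_of_neg hu, abs_of_neg hu]
    rcases le_total 1 (-u) with h | h
    · rw [min_eq_left h]; left; constructor <;> linarith
    · rw [min_eq_right h]
      rcases le_total u v with h' | h'
      · left; constructor <;> linarith
      · right; constructor <;> linarith
  · subst hu
    rw [Real.sign_zero, zero_mul]
    rcases le_total 0 v with h' | h'
    · left; constructor <;> linarith
    · right; constructor <;> linarith
  · rw [Real.sign_of_pos hu, abs_of_pos hu]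
    rcases le_total 1 u with h | h
    · rw [min_eq_left h]; right; constructor <;> linarith
    · rw [min_eq_right h]
      rcases le_total u v with h' | h'
      · left; constructor <;> linarith
      · right; constructor <;> linarith

theorem convex_affine_preimage {p n : ℕ} (M : Matrix (Fin n) (Fin p) ℝ) (c : Fin n → ℝ)
    (C : Set (Fin n → ℝ)) (hC : Convex ℝ C) : Convex ℝ {w | M.mulVec w + c ∈ C} := by
  intro z hz w hw a b ha hb hab
  have := hC hz hw ha hb hab
  have e : M.mulVec (a • z + b • w) + c = a • (M.mulVec z + c) + b • (M.mulVec w + c) := by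
    rw [Matrix.mulVec_add, Matrix.mulVec_smul, Matrix.mulVec_smul, smul_add, smul_add]
    have : c = a • c + b • c := by rw [← add_smul, hab, one_smul]
    nth_rewrite 1 [this]
    abel
  simpa only [Set.mem_ofPred_eq, e] using this

theorem quad_convex {n : ℕ} (P : Matrix (Fin n) (Fin n) ℝ) (hP : P.PosDef) (c : ℝ) :
    Convex ℝ {z : Fin n → ℝ | z ⬝ᵥ P.mulVec z < c} := by
  intro z hz w hw a b ha hb hab
  simp only [Set.mem_ofPred_eq] at *
  have hq : 0 ≤ (z - w) ⬝ᵥ P.mulVec (z - w) := by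
    simpa using hP.posSemidef.dotProduct_mulVec_nonneg (z - w)
  have hb' : b = 1 - a := by linarith
  have e : (a • z + b • w) ⬝ᵥ P.mulVec (a • z + b • w) =
      a * (z ⬝ᵥ P.mulVec z) + b * (w ⬝ᵥ P.mulVec w)
        - a * b * ((z - w) ⬝ᵥ P.mulVec (z - w)) := by
    simp only [Matrix.mulVec_add, Matrix.mulVec_sub, Matrix.mulVec_smul, dotProduct_add,
      add_dotProduct, sub_dotProduct, dotProduct_sub, smul_dotProduct, dotProduct_smul, smul_eq_mul]
    subst hb'
    ring
  rw [e]
  have h1 := mul_nonneg (mul_nonneg ha hb) hq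
  have h2 : a * (z ⬝ᵥ P.mulVec z) + b * (w ⬝ᵥ P.mulVec w) < c := by
    have := (convex_Iio c) hz hw ha hb hab
    simpa using this
  linarith

theorem Eiter_congr {n m : ℕ} (A : Matrix (Fin n) (Fin n) ℝ) (B : Matrix (Fin n) (Fin m) ℝ)
    (K : Matrix (Fin m) (Fin n) ℝ) (H : ℕ → Matrix (Fin m) (Fin n) ℝ)
    (S T : ℕ → Finset (Fin m)) (x : Fin n → ℝ) (k : ℕ) (h : ∀ i < k, S i = T i) :
    Eiter A B K H S x k = Eiter A B K H T x k := by
  induction k with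
  | zero => rfl
  | succ k ih =>
    rw [Eiter, Eiter, ih (fun i hi => h i (by omega)), h k (by omega)]

theorem sum_vecMulVec_mulVec {n m : ℕ} (B : Matrix (Fin n) (Fin m) ℝ)
    (K : Matrix (Fin m) (Fin n) ℝ) (s : Finset (Fin m)) (y : Fin n → ℝ) (r : Fin n) :
    (∑ j ∈ s, vecMulVec (fun r => B r j) (K j)).mulVec y r
      = ∑ j ∈ s, B r j * (K.mulVec y) j := by
  rw [Matrix.sum_mulVec, Finset.sum_apply]
  refine Finset.sum_congr rfl fun j _ => ?_
  simp [Matrix.mulVec, dotProduct, vecMulVec_apply, Finset.mul_sum, mul_assoc]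

theorem iter_mem_hull {n m : ℕ} (A : Matrix (Fin n) (Fin n) ℝ) (B : Matrix (Fin n) (Fin m) ℝ)
    (K : Matrix (Fin m) (Fin n) ℝ) (H : ℕ → Matrix (Fin m) (Fin n) ℝ)
    (x : Fin n → ℝ) (k : ℕ) (hH : ∀ i < k, ‖(H i).mulVec x‖ ≤ 1) :
    (Fmap A B K)^[k] x ∈ convexHull ℝ (Set.range fun S => Eiter A B K H S x k) := by
  induction k with
  | zero => exact subset_convexHull ℝ _ ⟨fun _ => ∅, rfl⟩
  | succ k ih =>
    have ih := ih (fun i hi => hH i (by omega))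
    rw [Function.iterate_succ_apply']
    set y := (Fmap A B K)^[k] x with hy
    set C := convexHull ℝ (Set.range fun S => Eiter A B K H S x (k+1)) with hC
    have hCc : Convex ℝ C := convex_convexHull ℝ _
    have step1 : ∀ s : Finset (Fin m),
        (A + ∑ j ∈ sᶜ, vecMulVec (fun r => B r j) (K j)).mulVec y
        + (∑ j ∈ s, vecMulVec (fun r => B r j) (H k j)).mulVec x ∈ C := by
      intro s
      refine convexHull_min ?_ (convex_affine_preimage _ _ C hCc) ih
      rintro _ ⟨S, rfl⟩
      refine subset_convexHull ℝ _ ⟨Function.update S k s, ?_⟩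
      simp only [Eiter, Function.update_self]
      rw [Eiter_congr A B K H (Function.update S k s) S x k
        (fun i hi => Function.update_of_ne (by omega) _ _)]
    have step2 : satur (K.mulVec y) ∈ convexHull ℝ
        (Set.pi Set.univ fun j => ({K.mulVec y j, (H k).mulVec x j} : Set ℝ)) := by
      rw [convexHull_pi]
      intro j _
      refine sat_mem_seg _ _ ?_
      have := norm_le_pi_norm ((H k).mulVec x) j
      rw [Real.norm_eq_abs] at this
      exact this.trans (hH k (by omega))
    have step3 := convexHull_min (t := {w | B.mulVec w + A.mulVec y ∈ C}) ?_
      (convex_affine_preimage B (A.mulVec y) C hCc) step2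
    · rw [Fmap, add_comm]; exact step3
    · intro w hw
      classical
      have := step1 (Finset.univ.filter fun j => w j ≠ K.mulVec y j)
      change B.mulVec w + A.mulVec y ∈ C
      convert this using 1
      ext r
      simp only [Matrix.add_mulVec, Pi.add_apply, sum_vecMulVec_mulVec]
      have hs : B.mulVec w r = ∑ j, B r j * w j := rfl
      rw [hs, ← Finset.sum_compl_add_sum (Finset.univ.filter fun j => w j ≠ K.mulVec y j)]
      have e1 : ∀ j ∈ (Finset.univ.filter fun j => w j ≠ K.mulVec y j)ᶜ,
          B r j * w j = B r j * K.mulVec y j := by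
        intro j hj
        have : w j = K.mulVec y j := by simpa using hj
        rw [this]
      have e2 : ∀ j ∈ (Finset.univ.filter fun j => w j ≠ K.mulVec y j),
          B r j * w j = B r j * (H k).mulVec x j := by
        intro j hj
        have h1 : w j ≠ K.mulVec y j := by simpa using hj
        have h2 := hw j (Set.mem_univ j)
        rcases h2 with h2 | h2
        · exact absurd h2 h1
        · rw [h2]
      rw [Finset.sum_congr rfl e1, Finset.sum_congr rfl e2]
      ring

/-- If the switching Lyapunov decrease holds at every iterated LDI vertex
`E_i^τ(x, S_1, …, S_τ)`, then it holds for `F_i^τ(x)` on the region where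
`‖H_{i,k} x‖_∞ ≤ 1` for all `k = 1, …, τ`. -/
theorem stmt8 {n m : ℕ} (A : Matrix (Fin n) (Fin n) ℝ) (B : Matrix (Fin n) (Fin m) ℝ)
    (K : Matrix (Fin m) (Fin n) ℝ) (H : ℕ → Matrix (Fin m) (Fin n) ℝ)
    (Pi Pj : Matrix (Fin n) (Fin n) ℝ) (hPi : Pi.PosDef) (hPj : Pj.PosDef)
    (τ : ℕ) (hτ : 1 ≤ τ)
    (h : ∀ x : Fin n → ℝ, x ≠ 0 → ∀ S : ℕ → Finset (Fin m),
      Eiter A B K H S x τ ⬝ᵥ Pj.mulVec (Eiter A B K H S x τ)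
        - x ⬝ᵥ Pi.mulVec x < 0) :
    ∀ x : Fin n → ℝ, x ≠ 0 → (∀ k < τ, ‖(H k).mulVec x‖ ≤ 1) →
      (Fmap A B K)^[τ] x ⬝ᵥ Pj.mulVec ((Fmap A B K)^[τ] x) < x ⬝ᵥ Pi.mulVec x := by
  intro x hx hH
  have hm := iter_mem_hull A B K H x τ hH
  refine convexHull_min ?_ (quad_convex Pj hPj (x ⬝ᵥ Pi.mulVec x)) hm
  rintro _ ⟨S, rfl⟩
  exact sub_neg.mp (h x hx S)
end
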